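/- arXiv:1502.01462 — 2 statements merged into one kernel-verified Lean document; each statement's English description precedes it below -/
import Mathlib

section
/- Let n, k be positive integers and define f : ℕ → ℝ by f(m) = (1/k) · Σ_{j=0}^{k−1} cos²(2πm / p_{n+j}). Then f(m) = 1 for every m with N ∣ m, and f(m) ≤ 2/3 for every m ∈ Lno of L^{k,n}. -/
/-- `nthPrime j` is the `j`-th prime number (1-indexed: `nthPrime 1 = 2`). -/
noncomputable def nthPrime (j : ℕ) : ℕ := Nat.nth Nat.Prime (j - 1)

/-- The residue of `m` mod `p` lies in `[p/8, 3p/8] ∪ [5p/8, 7p/8]` (over `ℝ`). -/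
def badResidue (p m : ℕ) : Prop :=
  ((m % p : ℕ) : ℝ) ∈ Set.Icc ((p : ℝ) / 8) (3 * p / 8) ∪ Set.Icc (5 * (p : ℝ) / 8) (7 * p / 8)

/-- The number of indices `j ∈ {n, …, n+k-1}` with `(m mod p_j)` in the bad intervals. -/
noncomputable def noCount (n k m : ℕ) : ℕ :=
  letI : DecidablePred fun j => badResidue (nthPrime j) m :=
    fun j => Classical.dec _
  ((Finset.Ico n (n + k)).filter fun j => badResidue (nthPrime j) m).card

/-- The set of no-instances of the promise problem `L^{k,n}`. -/
def Lno (n k : ℕ) : Set ℕ := {m | (2 * k : ℝ) / 3 ≤ noCount n k m}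

/-- `N = p_n ⋯ p_{n+k-1}`, the product of the `k` primes starting from the `n`-th. -/
noncomputable def Nprod (n k : ℕ) : ℕ := ∏ j ∈ Finset.Ico n (n + k), nthPrime j


open Real

/-- The residue mod `p` determines `cos² (2πm/p)`. -/
lemma cos_sq_two_pi_mul_div_mod (p m : ℕ) (hp : 0 < p) :
    Real.cos (2 * π * m / p) ^ 2 = 1 / 2 + Real.cos (4 * π * (m % p : ℕ) / p) / 2 := by
  have hp' : (p : ℝ) ≠ 0 := by positivity
  have hm : (m : ℝ) = p * (m / p : ℕ) + (m % p : ℕ) := by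
    exact_mod_cast (Nat.div_add_mod m p).symm
  have harg : 2 * (2 * π * m / p) =
      4 * π * (m % p : ℕ) / p + ((2 * (m / p) : ℕ) : ℝ) * (2 * π) := by
    rw [hm]
    push_cast
    field_simp
    ring
  rw [Real.cos_sq, harg, Real.cos_add_nat_mul_two_pi]

lemma cos_sq_le_half_of_badResidue {p m : ℕ} (hp : 0 < p) (h : badResidue p m) :
    Real.cos (2 * π * m / p) ^ 2 ≤ 1 / 2 := by
  rw [cos_sq_two_pi_mul_div_mod p m hp]
  have hp' : (0 : ℝ) < p := by positivity
  unfold badResidue at h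
  generalize ((m % p : ℕ) : ℝ) = r at h
  suffices Real.cos (4 * π * r / p) ≤ 0 by linarith
  rcases h with ⟨h₁, h₂⟩ | ⟨h₁, h₂⟩
  · apply Real.cos_nonpos_of_pi_div_two_le_of_le
    · rw [le_div_iff₀ hp']
      nlinarith [Real.pi_pos]
    · rw [div_le_iff₀ hp']
      nlinarith [Real.pi_pos]
  · rw [← Real.cos_sub_two_pi]
    apply Real.cos_nonpos_of_pi_div_two_le_of_le
    · rw [le_sub_iff_add_le, le_div_iff₀ hp']
      nlinarith [Real.pi_pos]
    · rw [sub_le_iff_le_add, div_le_iff₀ hp']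
      nlinarith [Real.pi_pos]

lemma cos_sq_eq_one_of_dvd {p m : ℕ} (hp : 0 < p) (h : p ∣ m) :
    Real.cos (2 * π * m / p) ^ 2 = 1 := by
  rw [cos_sq_two_pi_mul_div_mod p m hp, Nat.mod_eq_zero_of_dvd h]
  norm_num

lemma nthPrime_pos (j : ℕ) : 0 < nthPrime j :=
  (Nat.prime_nth_prime _).pos

/-- The acceptance probability `f(m) = (1/k) · Σ_{j<k} cos²(2πm / p_{n+j})` of the `2k`-state
QFA for `L^{k,n}` equals `1` on multiples of `N` and is at most `2/3` on no-instances. -/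
theorem qfa_acceptance_function_bounds (n k : ℕ) (hn : 0 < n) (hk : 0 < k) :
    (∀ m : ℕ, Nprod n k ∣ m →
      (1 / k : ℝ) * ∑ j ∈ Finset.range k,
        Real.cos (2 * π * m / nthPrime (n + j)) ^ 2 = 1) ∧
    (∀ m ∈ Lno n k,
      (1 / k : ℝ) * ∑ j ∈ Finset.range k,
        Real.cos (2 * π * m / nthPrime (n + j)) ^ 2 ≤ 2 / 3) := by
  classical
  have hk' : (0 : ℝ) < k := by positivity
  constructor
  · intro m hm
    rw [Finset.sum_congr rfl (g := fun _ => (1 : ℝ))]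
    · simp [hk'.ne']
    · intro j hj
      refine cos_sq_eq_one_of_dvd (nthPrime_pos _) (dvd_trans ?_ hm)
      refine Finset.dvd_prod_of_mem nthPrime ?_
      rw [Finset.mem_range] at hj
      exact Finset.mem_Ico.2 ⟨by omega, by omega⟩
  · intro m hm
    have hcount : (2 * k : ℝ) / 3 ≤
        (((Finset.Ico n (n + k)).filter fun j => badResidue (nthPrime j) m).card : ℝ) := by
      simpa only [Lno, noCount, Set.mem_ofPred_eq, Finset.filter_congr_decidable] using hm
    have hsum : ∑ j ∈ Finset.range k, Real.cos (2 * π * m / nthPrime (n + j)) ^ 2 ≤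
        ∑ j ∈ Finset.Ico n (n + k), (1 - (if badResidue (nthPrime j) m then (1 : ℝ) else 0) / 2) := by
      rw [Finset.sum_Ico_eq_sum_range, Nat.add_sub_cancel_left]
      refine Finset.sum_le_sum fun j _ => ?_
      split_ifs with h
      · linarith [cos_sq_le_half_of_badResidue (nthPrime_pos _) h]
      · linarith [Real.cos_sq_le_one (2 * π * m / nthPrime (n + j))]
    rw [Finset.sum_sub_distrib, ← Finset.sum_div, Finset.sum_boole] at hsum
    simp only [Finset.sum_const, Nat.card_Ico, Nat.add_sub_cancel_left, nsmul_eq_mul,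
      mul_one] at hsum
    rw [one_div, inv_mul_le_iff₀ hk']
    linarith
end

section
/- Let n ≥ 3 and k ≥ 1 be integers, and let d be a divisor of N such that the set R = {j ∈ {n,…,n+k−1} : p_j does not divide d} has at least 2k/3 elements. Then there exist infinitely many m ∈ ℕ such that d ∣ m and m ∈ Lno of L^{k,n}; specifically, there exist infinitely many m with m ≡ 0 (mod p_j) for every j ∈ {n,…,n+k−1} with p_j ∣ d, and (m mod p_j) ∈ [p_j/8, 3p_j/8] ∪ [5p_j/8, 7p_j/8] for every j ∈ R. -/
lemma nthPrime_prime (j : ℕ) : (nthPrime j).Prime := Nat.prime_nth_prime _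

lemma five_le_nthPrime {j : ℕ} (hj : 3 ≤ j) : 5 ≤ nthPrime j := by
  have h := Nat.nth_monotone Nat.infinite_setOfPred_prime (show 2 ≤ j - 1 by omega)
  rwa [Nat.nth_prime_two_eq_five] at h

lemma coprime_nthPrime {i j : ℕ} (hi : 1 ≤ i) (hj : 1 ≤ j) (hij : i ≠ j) :
    (nthPrime i).Coprime (nthPrime j) := by
  refine (Nat.coprime_primes (nthPrime_prime i) (nthPrime_prime j)).2 fun h => hij ?_
  have := Nat.nth_injective Nat.infinite_setOfPred_prime h
  omega

lemma badResidue_of_modEq {p m : ℕ} (hp : 5 ≤ p) (h : m ≡ p / 4 [MOD p]) : badResidue p m := by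
  have hm : m % p = p / 4 := Eq.trans h (Nat.mod_eq_of_lt (by omega))
  have h₁ : (p : ℝ) ≤ 8 * (p / 4 : ℕ) := by
    exact_mod_cast (show p ≤ 8 * (p / 4) by omega)
  have h₂ : 8 * ((p / 4 : ℕ) : ℝ) ≤ 3 * p := by
    exact_mod_cast (show 8 * (p / 4) ≤ 3 * p by omega)
  left
  rw [hm]
  constructor <;> linarith

/-- A divisor of a product of pairwise coprime primes divides every common multiple of those
primes of the product that divide it. -/
lemma dvd_of_dvd_prod_primes {ι : Type*} {s : Finset ι} {p : ι → ℕ} {d m : ℕ}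
    (hp : ∀ i ∈ s, (p i).Prime) (hc : (s : Set ι).Pairwise (Function.onFun Nat.Coprime p))
    (hd : d ∣ ∏ i ∈ s, p i) (hm : ∀ i ∈ s, p i ∣ d → p i ∣ m) : d ∣ m := by
  rw [← Finset.prod_filter_mul_prod_filter_not s (fun i => p i ∣ d)] at hd
  have hcop : d.Coprime (∏ i ∈ s with ¬ p i ∣ d, p i) := by
    refine Nat.Coprime.prod_right fun i hi => ?_
    rw [Finset.mem_filter] at hi
    exact (((hp i hi.1).coprime_iff_not_dvd).2 hi.2).symm
  refine (hcop.dvd_of_dvd_mul_right hd).trans (Finset.prod_dvd_of_isRelPrime ?_ ?_)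
  · intro i hi j hj hij
    exact Nat.coprime_iff_isRelPrime.1
      (hc (Finset.mem_filter.1 hi).1 (Finset.mem_filter.1 hj).1 hij)
  · intro i hi
    rw [Finset.mem_filter] at hi
    exact hm i hi.1 hi.2

/-- If `d ∣ N` and at least `2k/3` of the primes `p_n, …, p_{n+k-1}` do not divide `d`, then
there are infinitely many multiples of `d` that are no-instances of `L^{k,n}`; specifically,
infinitely many `m` with `p_j ∣ m` for every `j` with `p_j ∣ d`, and with `m mod p_j` in the
bad intervals for every `j` with `p_j ∤ d`. -/
theorem infinitely_many_no_instances_multiples (n k : ℕ) (hn : 3 ≤ n) (hk : 1 ≤ k)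
    (d : ℕ) (hd : d ∣ Nprod n k)
    (hR : (2 * k : ℝ) / 3 ≤
      ((Finset.Ico n (n + k)).filter fun j => ¬ nthPrime j ∣ d).card) :
    {m : ℕ | d ∣ m ∧ m ∈ Lno n k ∧
      (∀ j ∈ Finset.Ico n (n + k), nthPrime j ∣ d → nthPrime j ∣ m) ∧
      (∀ j ∈ Finset.Ico n (n + k), ¬ nthPrime j ∣ d → badResidue (nthPrime j) m)}.Infinite := by
  have hprime : ∀ j ∈ Finset.Ico n (n + k), (nthPrime j).Prime := fun j _ => nthPrime_prime j
  have hcop : (Finset.Ico n (n + k) : Set ℕ).Pairwise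
      (Function.onFun Nat.Coprime nthPrime) := by
    intro i hi j hj hij
    rw [Finset.mem_coe, Finset.mem_Ico] at hi hj
    exact coprime_nthPrime (by omega) (by omega) hij
  obtain ⟨x, hx⟩ := Nat.chineseRemainderOfFinset
    (fun j => if nthPrime j ∣ d then 0 else nthPrime j / 4) nthPrime
    (Finset.Ico n (n + k)) (fun j hj => (hprime j hj).ne_zero) hcop
  have hN : Nprod n k ≠ 0 := Finset.prod_ne_zero_iff.2 fun j hj => (hprime j hj).ne_zero
  have hinj : Function.Injective fun t : ℕ => x + Nprod n k * t := fun a b hab =>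
    mul_left_cancel₀ hN (Nat.add_left_cancel hab)
  refine (Set.infinite_range_of_injective hinj).mono ?_
  rintro _ ⟨t, rfl⟩
  have hmod : ∀ j ∈ Finset.Ico n (n + k), x + Nprod n k * t ≡
      (if nthPrime j ∣ d then 0 else nthPrime j / 4) [MOD nthPrime j] := by
    intro j hj
    have h0 : Nprod n k * t ≡ 0 [MOD nthPrime j] :=
      Nat.modEq_zero_iff_dvd.2 ((Finset.dvd_prod_of_mem nthPrime hj).mul_right t)
    exact (hx j hj).add h0
  have hdvd : ∀ j ∈ Finset.Ico n (n + k), nthPrime j ∣ d → nthPrime j ∣ x + Nprod n k * t := by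
    intro j hj hjd
    have h := hmod j hj
    rw [if_pos hjd] at h
    exact Nat.modEq_zero_iff_dvd.1 h
  have hbad : ∀ j ∈ Finset.Ico n (n + k), ¬ nthPrime j ∣ d →
      badResidue (nthPrime j) (x + Nprod n k * t) := by
    intro j hj hjd
    have h := hmod j hj
    rw [if_neg hjd] at h
    exact badResidue_of_modEq (five_le_nthPrime (hn.trans (Finset.mem_Ico.1 hj).1)) h
  refine ⟨dvd_of_dvd_prod_primes hprime hcop hd hdvd, hR.trans ?_, hdvd, hbad⟩
  refine Nat.cast_le.2 (Finset.card_le_card fun j hj => ?_)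
  rw [Finset.mem_filter] at hj
  exact (@Finset.mem_filter _ _ (_) _ _).2 ⟨hj.1, hbad j hj.1 hj.2⟩
end
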